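/- arXiv:0706.2118 — 2 statements merged into one kernel-verified Lean document; each statement's English description precedes it below -/
import Mathlib

section
/- Let 𝒫 be a graded poset and F : 𝒫 → Ab a functor. Then F' is an injective object of the functor category Ab^𝒫 if and only if F(p) is an injective abelian group for every p ∈ Ob(𝒫). -/
open Finset

/-- A graded poset (with the standing assumptions of Remark 2.5: the degree function is
order-reversing, adds one along preceding pairs, takes nonnegative values, and every
up-set is finite). -/
structure GradedPoset (P : Type) [PartialOrder P] : Type where
  deg : P → ℤ
  deg_antitone : ∀ ⦃p q : P⦄, p ≤ q → deg q ≤ deg p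
  deg_step : ∀ ⦃p q : P⦄, p < q → (∀ r, p ≤ r → r ≤ q → r = p ∨ r = q) → deg p = deg q + 1
  deg_nonneg : ∀ p, 0 ≤ deg p
  finite_up : ∀ p : P, {q : P | p ≤ q}.Finite

/-- A functor from a poset `P` to the category `Ab` of abelian groups. -/
structure PosetFunctor (P : Type) [PartialOrder P] : Type 1 where
  obj : P → Type
  grp : ∀ p, AddCommGroup (obj p)
  map : ∀ {p q : P}, p ≤ q → obj p →+ obj q
  map_id : ∀ (p : P) (x : obj p), map (le_refl p) x = x
  map_comp : ∀ {p q r : P} (h₁ : p ≤ q) (h₂ : q ≤ r) (x : obj p),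
    map h₂ (map h₁ x) = map (h₁.trans h₂) x

attribute [instance] PosetFunctor.grp

variable {P : Type} [PartialOrder P]

/-- A natural transformation between functors `P → Ab`. -/
structure PosetHom (F G : PosetFunctor P) : Type where
  app : ∀ p : P, F.obj p →+ G.obj p
  naturality : ∀ {p q : P} (h : p ≤ q) (x : F.obj p),
    G.map h (app p x) = app q (F.map h x)

/-- The constant functor with value `ℤ`. -/
def constZ (P : Type) [PartialOrder P] : PosetFunctor P where
  obj _ := ℤ
  grp _ := inferInstance
  map _ := AddMonoidHom.id ℤ
  map_id _ _ := rfl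
  map_comp _ _ _ := rfl

namespace PosetFunctor

/-- The inverse limit `lim F` of `F : P → Ab`, realized as the group of compatible
families (sections). -/
def sections (F : PosetFunctor P) : AddSubgroup (∀ p, F.obj p) where
  carrier := {x | ∀ (p q : P) (h : p ≤ q), F.map h (x p) = x q}
  zero_mem' := by intro p q h; simp
  add_mem' := by intro a b ha hb p q h; simp [map_add, ha p q h, hb p q h]
  neg_mem' := by intro a ha p q h; simp [ha p q h]

/-- The functor `F'` with `F'(p₀) = ∏_{p₀ ≤ p} F(p)`; a morphism `p₁ ≤ p₀` acts by
sending the factor indexed by `p₁ ≤ p` identically to the factor indexed by `p₀ ≤ p`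
when `p₀ ≤ p`, and by zero otherwise. -/
def prime (F : PosetFunctor P) : PosetFunctor P where
  obj p₀ := ∀ q : {q : P // p₀ ≤ q}, F.obj q.1
  grp _ := inferInstance
  map h := AddMonoidHom.mk' (fun x q => x ⟨q.1, h.trans q.2⟩) (fun _ _ => rfl)
  map_id _ _ := rfl
  map_comp _ _ _ := rfl

end PosetFunctor

/-- The subgroup `Ker_F(p₀) = ⋂_{p₀ < q} Ker (F(p₀ → q))`. -/
def kerAt (F : PosetFunctor P) (p₀ : P) : AddSubgroup (F.obj p₀) where
  carrier := {x | ∀ (q : P) (h : p₀ < q), F.map h.le x = 0}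
  zero_mem' := by intro q h; simp
  add_mem' := by intro a b ha hb q h; simp [map_add, ha q h, hb q h]
  neg_mem' := by intro a ha q h; simp [ha q h]

/-- `F` is `n`-condensed: `F(p) = 0` for `deg p < n` and `Ker_F(p) = 0` for `deg p > n`. -/
def IsCondensed (G : GradedPoset P) (F : PosetFunctor P) (n : ℕ) : Prop :=
  (∀ p : P, G.deg p < (n : ℤ) → ∀ x : F.obj p, x = 0) ∧
  (∀ p : P, (n : ℤ) < G.deg p → ∀ x ∈ kerAt F p, x = 0)

/-- The set `(p₀ ↓ P)_n` of objects above `p₀` of degree `n`. -/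
def degSet (G : GradedPoset P) (p₀ : P) (n : ℕ) : Set P :=
  {q : P | p₀ ≤ q ∧ G.deg q = (n : ℤ)}

/-- The functor `Ker'_F` (for an `n`-condensed functor `F`):
`Ker'_F(p₀) = ∏_{p ∈ (p₀↓P)_n} F(p)`. -/
def kerPrime (G : GradedPoset P) (F : PosetFunctor P) (n : ℕ) : PosetFunctor P where
  obj p₀ := ∀ q : degSet G p₀ n, F.obj q.1
  grp _ := inferInstance
  map h := AddMonoidHom.mk' (fun x q => x ⟨q.1, h.trans q.2.1, q.2.2⟩) (fun _ _ => rfl)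
  map_id _ _ := rfl
  map_comp _ _ _ := rfl

/-- The natural transformation `λ : F ⇒ Ker'_F` with components
`λ_{p₀} = ∏_{p ∈ (p₀↓P)_n} F(p₀ → p)`. -/
def lambdaNT (G : GradedPoset P) (F : PosetFunctor P) (n : ℕ) :
    PosetHom F (kerPrime G F n) where
  app p₀ := AddMonoidHom.mk' (fun x q => F.map q.2.1 x)
    (by intro a b; funext q; exact map_add _ a b)
  naturality := by
    intro p q h x
    funext r
    exact (F.map_comp h r.2.1 x).symm

/-! ### The cochain complex computing higher inverse limits -/

/-- Composable chains `p₀ ≤ p₁ ≤ … ≤ pₙ` in `P`. -/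
def ChainP (P : Type) [PartialOrder P] (n : ℕ) : Type :=
  {c : Fin (n + 1) → P // Monotone c}

/-- `n`-cochains of the cobar complex computing the derived functors of `lim` over `P`
with coefficients in `F`. -/
abbrev cochain (F : PosetFunctor P) (n : ℕ) : Type :=
  ∀ c : ChainP P n, F.obj (c.1 (Fin.last n))

/-- The `i`-th face of a chain. -/
def chainFace {n : ℕ} (i : Fin (n + 2)) (c : ChainP P (n + 1)) : ChainP P n :=
  ⟨c.1 ∘ i.succAbove, c.2.comp (Fin.strictMono_succAbove i).monotone⟩

/-- The differential of the cobar complex. -/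
noncomputable def cobarDiff (F : PosetFunctor P) (n : ℕ) : cochain F n →+ cochain F (n + 1) :=
  AddMonoidHom.mk'
    (fun ψ c => ∑ i : Fin (n + 2),
      ((-1 : ℤ) ^ (i : ℕ)) • F.map (c.2 (Fin.le_last (i.succAbove (Fin.last n))))
        (ψ (chainFace i c)))
    (by
      intro a b; funext c
      simp only [Pi.add_apply]
      rw [← Finset.sum_add_distrib]
      refine Finset.sum_congr rfl fun i _ => ?_
      exact (congrArg (fun y => ((-1 : ℤ) ^ (i : ℕ)) • y)
        (AddMonoidHom.map_add (F.map (c.2 (Fin.le_last (i.succAbove (Fin.last n)))))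
          (a (chainFace i c)) (b (chainFace i c)))).trans (smul_add _ _ _))

/-- Coboundaries of the cobar complex. -/
noncomputable def cobarCoboundaries (F : PosetFunctor P) : ∀ n : ℕ, AddSubgroup (cochain F n)
  | 0 => ⊥
  | n + 1 => (cobarDiff F n).range

/-- `H^n(P; F) = lim^n F`, the cohomology of `P` with coefficients in `F`, computed by
the cobar complex. -/
noncomputable def cohomologyOf (F : PosetFunctor P) (n : ℕ) : Type :=
  (cobarDiff F n).ker ⧸ ((cobarCoboundaries F n).addSubgroupOf (cobarDiff F n).ker)

noncomputable instance (F : PosetFunctor P) (n : ℕ) : AddCommGroup (cohomologyOf F n) :=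
  inferInstanceAs (AddCommGroup (_ ⧸ _))

/-- The `n`-th Betti number of `P` with coefficients in `F`: the rank of `H^n(P;F)`. -/
noncomputable def bettiOf (F : PosetFunctor P) (n : ℕ) : ℕ :=
  Module.finrank ℤ (cohomologyOf F n)

/-! ### Free functors, pure maps, local covering families -/

/-- A functor is free if all its values are finitely generated free abelian groups. -/
def IsFreeFunctor (F : PosetFunctor P) : Prop :=
  ∀ p : P, Module.Free ℤ (F.obj p) ∧ Module.Finite ℤ (F.obj p)

/-- A map of abelian groups is pure if its cokernel is a free abelian group. -/
def IsPureHom {A B : Type} [AddCommGroup A] [AddCommGroup B] (f : A →+ B) : Prop :=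
  Module.Free ℤ (B ⧸ f.range)

/-- Sections of `F` over a subset `S ⊆ P`, i.e. `lim_S F`. -/
def sectionsOnSet (F : PosetFunctor P) (S : Set P) : Set (∀ q : S, F.obj q.1) :=
  {x | ∀ (q r : S) (h : q.1 ≤ r.1), F.map h (x q) = x r}

/-- The restriction map `lim_{(p₀↓P)_*} F → ∏_{q ∈ S} F(q)` (for `S` a set of objects
strictly above `p₀`, realized by intersecting with `{q | p₀ < q}`). -/
def limRestriction (F : PosetFunctor P) (p₀ : P) (S : Set P) :
    ↥(sectionsOnSet F {q : P | p₀ < q}) → ∀ q : ↥(S ∩ {q : P | p₀ < q}), F.obj q.1 :=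
  fun x q => x.1 ⟨q.1, q.2.2⟩

/-- The map `F(p₀) → ∏_{q ∈ S} F(q)` (for `S` a set of objects above `p₀`, realized by
intersecting with `{q | p₀ ≤ q}`). -/
def detMap (F : PosetFunctor P) (p₀ : P) (S : Set P) :
    F.obj p₀ →+ ∀ q : ↥(S ∩ {q : P | p₀ ≤ q}), F.obj q.1 :=
  AddMonoidHom.mk' (fun x q => F.map q.2.2 x) (by intro a b; funext q; exact map_add _ a b)

/-- A local covering family `𝒥 = {J_n^{p₀}}` (Definition 3.4). -/
def IsLCF (G : GradedPoset P) (J : P → ℕ → Set P) : Prop :=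
  (∀ (p : P) (m : ℕ), J p m ⊆ degSet G p m) ∧
  (∀ (p : P) (m : ℕ), (m : ℤ) < G.deg p →
    (⋃ r ∈ J p (m + 1), degSet G r m) = degSet G p m) ∧
  (∀ (p : P) (m : ℕ), ∀ r ∈ J p (m + 1), J r m ⊆ J p m)

/-- `F` (an `n`-condensed free functor) is `𝒥`-determined (Definition 3.5). -/
def IsDetermined (G : GradedPoset P) (J : P → ℕ → Set P) (F : PosetFunctor P) (n : ℕ) :
    Prop :=
  (∀ p₀ : P, (n : ℤ) + 1 < G.deg p₀ →
    Function.Injective (limRestriction F p₀ (J p₀ n)) ∧ IsPureHom (detMap F p₀ (J p₀ n))) ∧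
  (∀ p₀ : P, G.deg p₀ = (n : ℤ) + 1 →
    IsPureHom (detMap F p₀ (J p₀ n)) ∧ Function.Injective (detMap F p₀ (J p₀ n)))

/-- The finite set `(p↓P)_n`. -/
noncomputable def degFinset (G : GradedPoset P) (p : P) (n : ℕ) : Finset P :=
  ((G.finite_up p).subset
    (show degSet G p n ⊆ {q : P | p ≤ q} from fun _ hq => hq.1)).toFinset

/-- The numbers `R_n^{p₀}` (Definition 4.1). -/
noncomputable def Rnum (G : GradedPoset P) : ℕ → P → ℤ
  | 0, _ => 1
  | m + 1, p => (∑ q ∈ degFinset G p m, Rnum G m q) - Rnum G m p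

/-- The finite set `J_n^p` (as a `Finset`, using finiteness of up-sets). -/
noncomputable def JFinset (G : GradedPoset P) (J : P → ℕ → Set P) (p : P) (n : ℕ) :
    Finset P :=
  ((G.finite_up p).inter_of_left (J p n)).toFinset

/-- Connectedness of a subset of a poset, viewed as a full subcategory. -/
def IsConnectedSet (S : Set P) : Prop :=
  S.Nonempty ∧ ∀ a b : S, Relation.ReflTransGen (fun x y : S => x.1 ≤ y.1 ∨ y.1 ≤ x.1) a b

/-- An adequate local covering family (Definition 4.2). -/
def IsAdequate (G : GradedPoset P) (J : P → ℕ → Set P) : Prop :=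
  IsLCF G J ∧
  (∀ p : P, 2 ≤ G.deg p → IsConnectedSet {q : P | p < q}) ∧
  (∀ (m : ℕ) (p : P), (m : ℤ) + 1 ≤ G.deg p →
    Rnum G m p = ∑ q ∈ JFinset G J p m, Rnum G m q)

/-! ### The global complex and global covering families -/

/-- Restriction of a product of abelian groups to a subset of the index set. -/
def restrictTo {ι : Type} {A : ι → Type} [∀ i, AddCommGroup (A i)] (S : Set ι) :
    (∀ i, A i) →+ ∀ i : S, A i.1 :=
  AddMonoidHom.mk' (fun x i => x i.1) (fun _ _ => rfl)

open Classical in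
/-- Extension by zero of a family indexed by a subset of the index set. -/
noncomputable def extendZero {ι : Type} {A : ι → Type} [∀ i, AddCommGroup (A i)]
    (S : Set ι) : (∀ i : S, A i.1) →+ ∀ i, A i :=
  AddMonoidHom.mk' (fun x i => if h : i ∈ S then x ⟨i, h⟩ else 0)
    (by intro a b; funext i; by_cases h : i ∈ S <;> simp [h])

/-- The map on full products induced by a natural transformation
`π : Ker'_F ⇒ F'` (the building block of the differential `d = ι ∘ ω`). -/
noncomputable def dhat (G : GradedPoset P) {F F' : PosetFunctor P} (n : ℕ)
    (π : PosetHom (kerPrime G F n) F') : (∀ p : P, F.obj p) →+ ∀ p : P, F'.obj p :=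
  AddMonoidHom.mk' (fun x p => π.app p (fun q => x q.1))
    (by intro a b; funext p; exact map_add (π.app p) _ _)

/-- The set `Ob_n(P)` of objects of degree `n`. -/
def obSet (G : GradedPoset P) (n : ℕ) : Set P := {p : P | G.deg p = (n : ℤ)}

/-- The differential `d_n = ι_{n+1} ∘ ω_{n+1} : ∏_{Ob_n} F_n(p) → ∏_{Ob_{n+1}} F_{n+1}(p)`. -/
noncomputable def obDiff (G : GradedPoset P) (F : ℕ → PosetFunctor P)
    (π : ∀ n : ℕ, PosetHom (kerPrime G (F n) n) (F (n + 1))) (n : ℕ) :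
    (∀ p : ↥(obSet G n), (F n).obj p.1) →+ ∀ p : ↥(obSet G (n + 1)), (F (n + 1)).obj p.1 :=
  (restrictTo (obSet G (n + 1))).comp ((dhat G n (π n)).comp (extendZero (obSet G n)))

/-- The composite `∏_{p ∈ Ob_n(P)∖K_n} F_n(p) → ∏_{p ∈ K_{n+1}} F_{n+1}(p)`
induced by the differential. -/
noncomputable def wMap (G : GradedPoset P) (F : ℕ → PosetFunctor P)
    (π : ∀ n : ℕ, PosetHom (kerPrime G (F n) n) (F (n + 1))) (K : ℕ → Set P) (n : ℕ) :
    (∀ p : ↥(obSet G n \ K n), (F n).obj p.1) →+ ∀ p : ↥(K (n + 1)), (F (n + 1)).obj p.1 :=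
  (restrictTo (K (n + 1))).comp ((dhat G n (π n)).comp (extendZero (obSet G n \ K n)))

/-- A global covering family (Definition 5.1). -/
def IsGCF (G : GradedPoset P) (F : ℕ → PosetFunctor P)
    (π : ∀ n : ℕ, PosetHom (kerPrime G (F n) n) (F (n + 1))) (K : ℕ → Set P) : Prop :=
  (∀ n : ℕ, K n ⊆ obSet G n) ∧
  (∀ n : ℕ, Function.Injective
    (fun (s : ↥(PosetFunctor.sections (F n))) => (fun p : ↥(K n) => s.1 p.1))) ∧
  (∀ n : ℕ, IsPureHom (wMap G F π K n))

/-- `Ob_n(P)` as a `Finset` (given that each degree level is finite). -/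
noncomputable def obFinset (G : GradedPoset P)
    (hfin : ∀ i : ℤ, {p : P | G.deg p = i}.Finite) (n : ℕ) : Finset P :=
  (hfin (n : ℤ)).toFinset

/-- `K_n` as a `Finset`. -/
noncomputable def KFinset (G : GradedPoset P)
    (hfin : ∀ i : ℤ, {p : P | G.deg p = i}.Finite) (K : ℕ → Set P) (n : ℕ) : Finset P :=
  ((hfin (n : ℤ)).inter_of_left (K n)).toFinset

/-- The Betti numbers `b_n^𝒦` of a global covering family (Definition 5.2). -/
noncomputable def bettiK (G : GradedPoset P)
    (hfin : ∀ i : ℤ, {p : P | G.deg p = i}.Finite) (K : ℕ → Set P) : ℕ → ℤ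
  | 0 => ∑ p ∈ KFinset G hfin K 0, Rnum G 0 p
  | n + 1 =>
      (∑ p ∈ KFinset G hfin K n, Rnum G n p) - (∑ p ∈ obFinset G hfin n, Rnum G n p) +
        ∑ p ∈ KFinset G hfin K (n + 1), Rnum G (n + 1) p

/-- The sequence of functors `F_0 = c_ℤ, F_1, F_2, …` of Proposition 4.3, together with
the connecting short exact sequences `0 → F_{n-1} → Ker'_{F_{n-1}} → F_n → 0` and all
their properties. -/
structure CondensedSequence (G : GradedPoset P) (J : P → ℕ → Set P) : Type 1 where
  F : ℕ → PosetFunctor P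
  pi : ∀ n : ℕ, PosetHom (kerPrime G (F n) n) (F (n + 1))
  F_zero : F 0 = constZ P
  pi_surj : ∀ (n : ℕ) (p : P), Function.Surjective ((pi n).app p)
  pi_ker : ∀ (n : ℕ) (p : P), ((pi n).app p).ker = ((lambdaNT G (F n) n).app p).range
  condensed : ∀ n : ℕ, IsCondensed G (F n) n
  free : ∀ n : ℕ, IsFreeFunctor (F n)
  determined : ∀ n : ℕ, IsDetermined G J (F n) n
  rank_eq : ∀ (n : ℕ) (p : P), (n : ℤ) ≤ G.deg p →
    (Module.finrank ℤ ((F n).obj p) : ℤ) = Rnum G n p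

/-! ### Simplex-like posets -/

/-- The poset `Δ_n` of faces of the standard `n`-dimensional simplex, ordered by
inclusion: faces are the nonempty subsets of the vertex set. -/
def SimplexPoset (n : ℕ) : Type := {s : Finset (Fin (n + 1)) // s.Nonempty}

instance (n : ℕ) : PartialOrder (SimplexPoset n) := Subtype.partialOrder _

/-- A poset `P` is simplex-like (with dimension function `d`) if for every `p` the
category `(P ↓ p)` is isomorphic to `Δ_{d p}`. -/
def SimplexLike (P : Type) [PartialOrder P] (d : P → ℕ) : Prop :=
  ∀ p : P, Nonempty ({q : P // q ≤ p} ≃o SimplexPoset (d p))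

/-- An object `I` of the abelian category `Ab^𝒫` is injective if every natural
transformation into `I` extends along objectwise-injective natural transformations. -/
def IsInjectiveFunctor {P : Type} [PartialOrder P] (I : PosetFunctor P) : Prop :=
  ∀ (A B : PosetFunctor P) (f : PosetHom A B),
    (∀ p : P, Function.Injective (f.app p)) →
      ∀ g : PosetHom A I, ∃ h : PosetHom B I,
        ∀ (p : P) (x : A.obj p), h.app p (f.app p x) = g.app p x

/-- A family of homs `A(r) → F(r)` induces a natural transformation `A ⇒ F'`. -/
def homOfFamily {P : Type} [PartialOrder P] (A F : PosetFunctor P)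
    (φ : ∀ r : P, A.obj r →+ F.obj r) : PosetHom A F.prime where
  app q := AddMonoidHom.mk' (fun x r => φ r.1 (A.map r.2 x))
    (by intro a b; funext r; exact (congrArg (φ r.1) (map_add (A.map r.2) a b)).trans
          (map_add (φ r.1) _ _))
  naturality := by
    intro p q h x
    funext r
    exact congrArg (φ r.1) (A.map_comp h r.2 x).symm

/-- The functor with value `X` on objects below `p` and zero elsewhere. -/
def belowFunctor {P : Type} [PartialOrder P] (p : P) (X : Type) [AddCommGroup X] :
    PosetFunctor P where
  obj q := PLift (q ≤ p) → X
  grp _ := inferInstance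
  map h := AddMonoidHom.mk' (fun x hr => x ⟨h.trans hr.down⟩) (fun _ _ => rfl)
  map_id _ _ := rfl
  map_comp _ _ _ := rfl

/-- Functoriality of `belowFunctor` in the group. -/
def belowHom {P : Type} [PartialOrder P] (p : P) {X Y : Type} [AddCommGroup X]
    [AddCommGroup Y] (f : X →+ Y) : PosetHom (belowFunctor p X) (belowFunctor p Y) where
  app q := AddMonoidHom.mk' (fun (x : PLift (q ≤ p) → X) (h : PLift (q ≤ p)) => f (x h))
    (by intro a b; funext h; exact map_add f (a h) (b h))
  naturality _ _ := rfl

/-- **Theorem 2.7(d).** Let `𝒫` be a graded poset and `F : 𝒫 → Ab` a functor. Then `F'`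
is an injective object of `Ab^𝒫` if and only if `F(p)` is an injective abelian group
(equivalently, injective `ℤ`-module) for every object `p` of `𝒫`. -/
theorem theorem_2_7_d {P : Type} [PartialOrder P] (GP : GradedPoset P)
    (F : PosetFunctor P) :
    IsInjectiveFunctor F.prime ↔ ∀ p : P, Module.Injective ℤ (F.obj p) := by
  classical
  constructor
  · intro H p
    constructor
    intro X Y _ _ iX iY f hf g
    have eX : iX = AddCommGroup.toIntModule X := Subsingleton.elim _ _
    have eY : iY = AddCommGroup.toIntModule Y := Subsingleton.elim _ _
    subst eX eY
    let g0 : (belowFunctor p X).obj p →+ F.obj p :=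
      AddMonoidHom.mk' (fun x : PLift (p ≤ p) → X => g (x ⟨le_rfl⟩)) (fun a b => map_add g _ _)
    let φ : ∀ r : P, (belowFunctor p X).obj r →+ F.obj r :=
      Function.update (fun r => (0 : (belowFunctor p X).obj r →+ F.obj r)) p g0
    have hφ : φ p = g0 := Function.update_self _ _ _
    obtain ⟨h, hh⟩ := H (belowFunctor p X) (belowFunctor p Y) (belowHom p f.toAddMonoidHom)
      (fun q x y hxy => by
        funext hq
        exact hf (congrFun hxy hq))
      (homOfFamily _ F φ)
    let k : Y →+ F.obj p :=
      AddMonoidHom.mk' (fun y => h.app p (fun _ : PLift (p ≤ p) => y) ⟨p, le_rfl⟩)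
        (fun a b => congrFun
          (map_add (h.app p) (fun _ : PLift (p ≤ p) => a) (fun _ : PLift (p ≤ p) => b)) ⟨p, le_rfl⟩)
    refine ⟨k.toIntLinearMap, fun x => ?_⟩
    have h1 := congrFun (hh p (fun _ : PLift (p ≤ p) => x)) ⟨p, le_rfl⟩
    refine Eq.trans h1 ?_
    change φ p ((belowFunctor p X).map le_rfl (fun _ : PLift (p ≤ p) => x)) = g x
    rw [hφ]
    rfl
  · intro H A B f hf g
    have key : ∀ r : P, ∃ φ : B.obj r →+ F.obj r,
        ∀ x, φ (f.app r x) = g.app r x ⟨r, le_rfl⟩ := by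
      intro r
      let g0 : A.obj r →+ F.obj r :=
        AddMonoidHom.mk' (fun x => g.app r x ⟨r, le_rfl⟩)
          (fun a b => congrFun (map_add (g.app r) a b) ⟨r, le_rfl⟩)
      obtain ⟨k, hk⟩ := (H r).out (f.app r).toIntLinearMap (hf r) g0.toIntLinearMap
      exact ⟨k.toAddMonoidHom, hk⟩
    choose φ hφ using key
    refine ⟨homOfFamily B F φ, fun p x => ?_⟩
    funext r
    change φ r.1 (B.map r.2 (f.app p x)) = g.app p x r
    rw [f.naturality, hφ, ← g.naturality]
    rfl
end

section
/- Let 𝒫 be a graded poset with an adequate local covering family and a global covering family 𝒦. Then for each n ≥ 1 there is a split short exact sequence 0 → ∏_{p ∈ Ob_{n−1}(𝒫)∖K_{n−1}} F_{n−1}(p) → ∏_{p ∈ K_n} F_n(p) → B_n^𝒦 → 0, where the first map is induced by the differential d_{n−1}, and B_n^𝒦 is a free abelian group of rank b_n^𝒦. -/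
open Finset

variable {P : Type} [PartialOrder P]

theorem lambda_inj_aux {P : Type} [PartialOrder P] (G : GradedPoset P) (F : PosetFunctor P)
    (n : ℕ) (hc : IsCondensed G F n) :
    ∀ (k : ℕ) (p : P), {q : P | p ≤ q}.ncard = k → ∀ y : F.obj p,
      (∀ (q : P) (h : p ≤ q), G.deg q = (n : ℤ) → F.map h y = 0) → y = 0 := by
  intro k
  induction k using Nat.strong_induction_on with
  | _ k ih =>
    intro p hp y hy
    rcases lt_trichotomy (G.deg p) (n : ℤ) with h | h | h
    · exact hc.1 p h y
    · have := hy p le_rfl h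
      rwa [F.map_id] at this
    · refine hc.2 p h y ?_
      intro q hq
      refine ih _ ?_ q rfl _ ?_
      · rw [← hp]
        refine Set.ncard_lt_ncard ?_ (G.finite_up p)
        refine ⟨fun r hr => hq.le.trans hr, fun hsub => ?_⟩
        exact absurd (hsub (le_refl p)) (not_le_of_gt hq)
      · intro r hr hd
        rw [F.map_comp]
        exact hy r _ hd

theorem wMap_inj_aux {P : Type} [PartialOrder P] (G : GradedPoset P) (J : P → ℕ → Set P)
    (S : CondensedSequence G J)
    (K : ℕ → Set P) (hK : IsGCF G S.F S.pi K) (n : ℕ) :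
    Function.Injective (wMap G S.F S.pi K n) := by
  rw [injective_iff_map_eq_zero]
  intro x hx
  obtain ⟨z, hz⟩ : ∃ z, z = extendZero (A := (S.F n).obj) (obSet G n \ K n) x := ⟨_, rfl⟩
  have hx' : ∀ p : K (n + 1), dhat G n (S.pi n) z p.1 = 0 := by
    intro p
    rw [hz]
    exact congrFun hx p
  have hsec : dhat G n (S.pi n) z ∈ PosetFunctor.sections (S.F (n + 1)) := by
    intro p q h
    exact (S.pi n).naturality h _
  have h0 : ∀ p, dhat G n (S.pi n) z p = 0 := by
    have := @hK.2.1 (n + 1) ⟨_, hsec⟩ 0 (by funext p; exact hx' p)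
    intro p
    exact congrFun (congrArg Subtype.val this) p
  have hy : ∀ p, ∃ y : (S.F n).obj p, ∀ (q : P) (h : p ≤ q), G.deg q = (n : ℤ) →
      (S.F n).map h y = z q := by
    intro p
    have h1 : (fun q : degSet G p n => z q.1) ∈ ((S.pi n).app p).ker := h0 p
    rw [S.pi_ker] at h1
    obtain ⟨y, hy⟩ := h1
    exact ⟨y, fun q h hd => congrFun hy ⟨q, h, hd⟩⟩
  choose y hy using hy
  have hysec : y ∈ PosetFunctor.sections (S.F n) := by
    intro p q h
    rw [← sub_eq_zero]
    refine lambda_inj_aux G (S.F n) n (S.condensed n) _ q rfl _ ?_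
    intro r hr hd
    rw [map_sub, (S.F n).map_comp, hy _ _ _ hd, hy _ _ _ hd, sub_self]
  have hyz : ∀ p, G.deg p = (n : ℤ) → y p = z p := by
    intro p hp
    rw [← hy p p le_rfl hp, (S.F n).map_id]
  have hy0 : ∀ p, y p = 0 := by
    have := @hK.2.1 n ⟨_, hysec⟩ 0 (by
      funext p
      change y p.1 = 0
      rw [hyz _ (hK.1 n p.2), hz]
      exact dif_neg (fun h => h.2 p.2))
    intro p
    exact congrFun (congrArg Subtype.val this) p
  funext p
  have h2 := hyz p.1 p.2.1
  rw [hy0, hz] at h2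
  have h3 : extendZero (A := (S.F n).obj) (obSet G n \ K n) x p.1 = x p := dif_pos p.2
  rw [h3] at h2
  exact h2.symm

theorem split_aux {A B : Type} [AddCommGroup A] [AddCommGroup B] [Module.Finite ℤ B]
    (f : A →+ B) (hf : Function.Injective f) (hp : Module.Free ℤ (B ⧸ f.range)) :
    (Module.finrank ℤ (B ⧸ f.range) : ℤ) = Module.finrank ℤ B - Module.finrank ℤ A ∧
    ∃ r : B →+ A, r.comp f = AddMonoidHom.id _ := by
  let g : B →ₗ[ℤ] (B ⧸ f.range) := (QuotientAddGroup.mk' f.range).toIntLinearMap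
  let f' : A →ₗ[ℤ] B := f.toIntLinearMap
  have hg : Function.Surjective g := QuotientAddGroup.mk'_surjective f.range
  have hex : Function.Exact f' g := by
    intro b
    change ((b : B ⧸ f.range) = 0) ↔ _
    rw [QuotientAddGroup.eq_zero_iff]
    rfl
  constructor
  · have h1 := Submodule.finrank_quotient_add_finrank (LinearMap.ker g)
    rw [(g.quotKerEquivOfSurjective hg).finrank_eq, hex.linearMap_ker_eq,
      LinearMap.finrank_range_of_inj (f := f') hf] at h1
    omega
  · obtain ⟨s, hs⟩ := Module.projective_lifting_property g LinearMap.id hg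
    have h2 : Function.Injective f' ∧ ∃ l, g ∘ₗ l = LinearMap.id := ⟨hf, s, hs⟩
    obtain ⟨l, hl⟩ := ((hex.split_tfae'.out 0 1 :).1 h2).2
    exact ⟨l.toAddMonoidHom, AddMonoidHom.ext fun a => LinearMap.congr_fun hl a⟩

theorem rank_prod_aux {P : Type} [PartialOrder P] (G : GradedPoset P) (J : P → ℕ → Set P)
    (S : CondensedSequence G J) (n : ℕ) (T : Set P) (hT : T ⊆ obSet G n) (hf : T.Finite) :
    Module.Finite ℤ (∀ p : T, (S.F n).obj p.1) ∧
    (Module.finrank ℤ (∀ p : T, (S.F n).obj p.1) : ℤ) = ∑ p ∈ hf.toFinset, Rnum G n p := by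
  have := hf.fintype
  have h1 := fun p => (S.free n p).1
  have h2 := fun p => (S.free n p).2
  refine ⟨inferInstance, ?_⟩
  rw [Module.finrank_pi_fintype, Nat.cast_sum,
    Finset.sum_congr rfl (fun (p : T) _ => S.rank_eq n p.1 (le_of_eq (hT p.2).symm))]
  rw [← Finset.sum_subtype hf.toFinset (fun x => by simp) (fun p => Rnum G n p)]

/-- **Lemma 5.6.** Let `𝒫` be a graded poset with an adequate local covering family and
a global covering family `𝒦`. Then for each `n ≥ 1` there is a split short exact
sequence `0 → ∏_{p ∈ Ob_{n−1}𝒫∖K_{n−1}} F_{n−1}(p) → ∏_{p ∈ K_n} F_n(p) → B_n^𝒦 → 0`,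
where the first map is induced by the differential `d_{n−1}`, and `B_n^𝒦` is a free
abelian group of rank `b_n^𝒦`. (Here the statement is given for the map indexed
`n → n+1`, i.e. for all `n ≥ 1` in the paper's indexing.) -/
theorem lemma_5_6 {P : Type} [PartialOrder P] (G : GradedPoset P) (J : P → ℕ → Set P)
    (hJ : IsAdequate G J) (S : CondensedSequence G J)
    (hfin : ∀ i : ℤ, {p : P | G.deg p = i}.Finite)
    (K : ℕ → Set P) (hK : IsGCF G S.F S.pi K) (n : ℕ) :
    Function.Injective (wMap G S.F S.pi K n) ∧
    Module.Free ℤ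
      ((∀ p : ↥(K (n + 1)), (S.F (n + 1)).obj p.1) ⧸ (wMap G S.F S.pi K n).range) ∧
    (Module.finrank ℤ
        ((∀ p : ↥(K (n + 1)), (S.F (n + 1)).obj p.1) ⧸ (wMap G S.F S.pi K n).range) : ℤ) =
      bettiK G hfin K (n + 1) ∧
    ∃ r : (∀ p : ↥(K (n + 1)), (S.F (n + 1)).obj p.1) →+
        ∀ p : ↥(obSet G n \ K n), (S.F n).obj p.1,
      r.comp (wMap G S.F S.pi K n) = AddMonoidHom.id _ := by
  have hinj := wMap_inj_aux G J S K hK n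
  have hfree := hK.2.2 n
  have hKf : ∀ m, (K m).Finite := fun m => (hfin (m : ℤ)).subset (hK.1 m)
  have hof : (obSet G n \ K n).Finite := (hfin (n : ℤ)).subset Set.sdiff_subset
  obtain ⟨hB, rB⟩ := rank_prod_aux G J S (n + 1) (K (n + 1)) (hK.1 _) (hKf _)
  obtain ⟨-, rA⟩ := rank_prod_aux G J S n (obSet G n \ K n) Set.sdiff_subset hof
  obtain ⟨hr, hs⟩ := split_aux _ hinj hfree
  refine ⟨hinj, hfree, ?_, hs⟩
  rw [hr, rB, rA]
  have e1 : (hKf (n + 1)).toFinset = KFinset G hfin K (n + 1) := by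
    ext p
    simp only [KFinset, Set.Finite.mem_toFinset]
    exact ⟨fun h => ⟨hK.1 _ h, h⟩, fun h => h.2⟩
  have e2 : (∑ p ∈ hof.toFinset, Rnum G n p) + ∑ p ∈ KFinset G hfin K n, Rnum G n p
      = ∑ p ∈ obFinset G hfin n, Rnum G n p := by
    classical
    rw [← Finset.sum_union]
    · refine Finset.sum_congr ?_ fun _ _ => rfl
      ext p
      have h1 := @hK.1 n p
      simp only [KFinset, obFinset, Finset.mem_union, Set.Finite.mem_toFinset]
      change (p ∈ obSet G n ∧ p ∉ K n) ∨ (p ∈ obSet G n ∧ p ∈ K n) ↔ p ∈ obSet G n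
      tauto
    · rw [Finset.disjoint_left]
      intro p hp hp'
      simp only [KFinset, Set.Finite.mem_toFinset] at hp hp'
      exact hp.2 hp'.2
  rw [e1]
  simp only [bettiK]
  linarith
end
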